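/- Let R > 1 and let F be analytic on the open ball of radius R centered at 0, with F(z) ≠ 0 for all |z| < 1, and such that every zero z₀ of F with |z₀| = 1 is simple (i.e. F'(z₀) ≠ 0). Let f be the sequence of Taylor coefficients of F at 0 and set φ(n) = ∑_{k=0}^n 1/w_k. Then there exist a constant C > 0 and, for each n ≥ 1, a polynomial p_n of degree at most n such that ∑_{k=0}^∞ |(p_n·f)_k| ≤ C for all n, and ‖p_n·f − 1‖²_{H_w} ≤ C/φ(n) for all n. -/

import Mathlib

open scoped BigOperators ComplexConjugate
open Filter

def MemHw (w : ℕ → ℝ) (f : ℕ → ℂ) : Prop :=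
  Summable fun n => w n * ‖f n‖ ^ 2

noncomputable def normSqHw (w : ℕ → ℝ) (f : ℕ → ℂ) : ℝ :=
  ∑' n, w n * ‖f n‖ ^ 2

noncomputable def normHw (w : ℕ → ℝ) (f : ℕ → ℂ) : ℝ :=
  Real.sqrt (normSqHw w f)

noncomputable def innerHw (w : ℕ → ℝ) (f g : ℕ → ℂ) : ℂ :=
  ∑' n, (w n : ℂ) * f n * conj (g n)

noncomputable def cProd (f g : ℕ → ℂ) : ℕ → ℂ :=
  fun n => ∑ k ∈ Finset.range (n + 1), f k * g (n - k)

def onePS : ℕ → ℂ := fun n => if n = 0 then 1 else 0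

def IsPolySeq (p : ℕ → ℂ) : Prop := ∃ N, ∀ n, N < n → p n = 0

def DegLE (p : ℕ → ℂ) (n : ℕ) : Prop := ∀ m, n < m → p m = 0

def CyclicHw (w : ℕ → ℝ) (f : ℕ → ℂ) : Prop :=
  ∀ ε : ℝ, 0 < ε → ∃ p : ℕ → ℂ, IsPolySeq p ∧ normHw w (cProd p f - onePS) < ε

noncomputable def taylorCoeff (F : ℂ → ℂ) (n : ℕ) : ℂ :=
  iteratedDeriv n F 0 / (n.factorial : ℂ)

noncomputable def phiW (w : ℕ → ℝ) (k : ℕ) : ℝ :=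
  ∑ j ∈ Finset.range (k + 1), 1 / w j

def oneSubZ : ℕ → ℂ := fun k => if k = 0 then 1 else if k = 1 then -1 else 0

def zPow (i : ℕ) (f : ℕ → ℂ) : ℕ → ℂ :=
  fun m => if i ≤ m then f (m - i) else 0

/-- `e` is small in the sense required of the error `p * f - 1` at degree `n`. -/
structure SmallError (w : ℕ → ℝ) (n : ℕ) (C : ℝ) (e : PowerSeries ℂ) : Prop where
  summable_norm : Summable fun k => ‖PowerSeries.coeff k e‖
  tsum_norm_le : ∑' k, ‖PowerSeries.coeff k e‖ ≤ C
  memHw : MemHw w fun k => PowerSeries.coeff k e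
  normSqHw_le : phiW w n * normSqHw w (fun k => PowerSeries.coeff k e) ≤ C

/-- `a` is approximated by `p * f` with polynomials `p` of degree at most `n`, with errors that
are uniformly bounded in the Wiener norm and of squared `H_w` norm `O(1 / phiW w n)`. -/
def Approximable (w : ℕ → ℝ) (f a : PowerSeries ℂ) : Prop :=
  ∃ C : ℝ, ∀ n : ℕ, ∃ p : PowerSeries ℂ,
    DegLE (fun k => PowerSeries.coeff k p) n ∧ SmallError w n C (p * f - a)

/-- The coefficients of `h` decay exponentially. -/
def ExpDecay (h : PowerSeries ℂ) : Prop :=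
  ∃ C ρ : ℝ, 0 < C ∧ 0 < ρ ∧ ρ < 1 ∧ ∀ k, ‖PowerSeries.coeff k h‖ ≤ C * ρ ^ k

lemma phiW_pos {w : ℕ → ℝ} (hw : ∀ n, 0 < w n) (n : ℕ) : 0 < phiW w n :=
  Finset.sum_pos (fun j _ => one_div_pos.2 (hw j)) ⟨0, by simp⟩

lemma SmallError.nonneg {w : ℕ → ℝ} {n : ℕ} {C : ℝ} {e : PowerSeries ℂ}
    (h : SmallError w n C e) : 0 ≤ C :=
  (tsum_nonneg fun _ => norm_nonneg _).trans h.tsum_norm_le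

lemma SmallError.add {w : ℕ → ℝ} (hw : ∀ n, 0 < w n) {n : ℕ} {C C' : ℝ} {e e' : PowerSeries ℂ}
    (h : SmallError w n C e) (h' : SmallError w n C' e') :
    SmallError w n (2 * C + 2 * C') (e + e') := by
  have hC := h.nonneg
  have hC' := h'.nonneg
  have le1 : ∀ k, ‖PowerSeries.coeff k (e + e')‖ ≤
      ‖PowerSeries.coeff k e‖ + ‖PowerSeries.coeff k e'‖ := fun k => by
    rw [map_add]; exact norm_add_le _ _
  have le2 : ∀ k, w k * ‖PowerSeries.coeff k (e + e')‖ ^ 2 ≤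
      2 * (w k * ‖PowerSeries.coeff k e‖ ^ 2) + 2 * (w k * ‖PowerSeries.coeff k e'‖ ^ 2) :=
    fun k => by
      have : ‖PowerSeries.coeff k (e + e')‖ ^ 2 ≤
          2 * ‖PowerSeries.coeff k e‖ ^ 2 + 2 * ‖PowerSeries.coeff k e'‖ ^ 2 := by
        nlinarith [le1 k, norm_nonneg (PowerSeries.coeff k (e + e')),
          sq_nonneg (‖PowerSeries.coeff k e‖ - ‖PowerSeries.coeff k e'‖),
          pow_le_pow_left₀ (norm_nonneg _) (le1 k) 2]
      nlinarith [mul_le_mul_of_nonneg_left this (hw k).le]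
  have s1 := h.summable_norm.add h'.summable_norm
  have s2 := (Summable.mul_left 2 h.memHw).add (Summable.mul_left 2 h'.memHw)
  have s1' := Summable.of_nonneg_of_le (fun _ => norm_nonneg _) le1 s1
  have s2' := Summable.of_nonneg_of_le
    (fun k => mul_nonneg (hw k).le (sq_nonneg _)) le2 s2
  refine ⟨s1', ?_, s2', ?_⟩
  · have := s1'.tsum_le_tsum le1 s1
    rw [h.summable_norm.tsum_add h'.summable_norm] at this
    linarith [h.tsum_norm_le, h'.tsum_norm_le]
  · have := s2'.tsum_le_tsum le2 s2
    rw [Summable.tsum_add (Summable.mul_left 2 h.memHw) (Summable.mul_left 2 h'.memHw),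
      tsum_mul_left, tsum_mul_left] at this
    have h1 := h.normSqHw_le
    have h2 := h'.normSqHw_le
    unfold normSqHw at *
    nlinarith [mul_le_mul_of_nonneg_left this (phiW_pos hw n).le]

lemma SmallError.smul {w : ℕ → ℝ} {n : ℕ} {C : ℝ} {e : PowerSeries ℂ}
    (h : SmallError w n C e) (c : ℂ) :
    SmallError w n ((‖c‖ + ‖c‖ ^ 2) * C) (c • e) := by
  have hC := h.nonneg
  have eq1 : (fun k => ‖PowerSeries.coeff k (c • e)‖) =
      fun k => ‖c‖ * ‖PowerSeries.coeff k e‖ := by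
    ext k; simp
  have eq2 : (fun k => w k * ‖PowerSeries.coeff k (c • e)‖ ^ 2) =
      fun k => ‖c‖ ^ 2 * (w k * ‖PowerSeries.coeff k e‖ ^ 2) := by
    ext k; simp; ring
  have h1 := h.tsum_norm_le
  have h2 := h.normSqHw_le
  refine ⟨?_, ?_, ?_, ?_⟩
  · rw [eq1]; exact h.summable_norm.mul_left _
  · rw [eq1, tsum_mul_left]
    nlinarith [mul_le_mul_of_nonneg_left h1 (norm_nonneg c), sq_nonneg ‖c‖,
      mul_nonneg (sq_nonneg ‖c‖) hC]
  · unfold MemHw; rw [eq2]; exact Summable.mul_left _ h.memHw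
  · unfold normSqHw at *
    rw [eq2, tsum_mul_left]
    nlinarith [mul_le_mul_of_nonneg_left h2 (sq_nonneg ‖c‖), mul_nonneg (norm_nonneg c) hC]

lemma Approximable.add {w : ℕ → ℝ} (hw : ∀ n, 0 < w n) {f a b : PowerSeries ℂ}
    (ha : Approximable w f a) (hb : Approximable w f b) : Approximable w f (a + b) := by
  obtain ⟨C, hC⟩ := ha
  obtain ⟨C', hC'⟩ := hb
  refine ⟨2 * C + 2 * C', fun n => ?_⟩
  obtain ⟨p, hp, h⟩ := hC n
  obtain ⟨q, hq, h'⟩ := hC' n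
  refine ⟨p + q, fun m hm => ?_, ?_⟩
  · have h1 := hp m hm
    have h2 := hq m hm
    simp only at h1 h2
    simp [h1, h2]
  · convert h.add hw h' using 1
    ring

lemma Approximable.smul {w : ℕ → ℝ} {f a : PowerSeries ℂ}
    (ha : Approximable w f a) (c : ℂ) : Approximable w f (c • a) := by
  obtain ⟨C, hC⟩ := ha
  refine ⟨(‖c‖ + ‖c‖ ^ 2) * C, fun n => ?_⟩
  obtain ⟨p, hp, h⟩ := hC n
  refine ⟨c • p, fun m hm => by simpa using Or.inr (hp m hm), ?_⟩
  convert h.smul c using 1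
  rw [smul_mul_assoc, smul_sub]

lemma exists_forall_add_le_of_eventually_le {σ : ℝ} (hσ : 0 < σ) (N : ℕ) :
    ∀ w : ℕ → ℝ, (∀ n, 0 < w n) → (∀ n, N ≤ n → w (n + 1) ≤ σ * w n) →
      ∃ M : ℝ, 0 < M ∧ ∀ k i, w (k + i) ≤ M * σ ^ i * w k := by
  induction N with
  | zero =>
    refine fun w _ h => ⟨1, one_pos, fun k i => ?_⟩
    induction i with
    | zero => simp
    | succ i ih =>
      calc w (k + (i + 1)) ≤ σ * w (k + i) := h (k + i) (Nat.zero_le _)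
        _ ≤ σ * (1 * σ ^ i * w k) := by gcongr
        _ = 1 * σ ^ (i + 1) * w k := by ring
  | succ N ih =>
    intro w hw h
    obtain ⟨M, hM, hMw⟩ := ih (fun n => w (n + 1)) (fun n => hw _) fun n hn => h _ (by omega)
    have h0 := hw 0
    refine ⟨M + M * w 1 / (w 0 * σ) + 1, by have := hw 1; positivity, fun k i => ?_⟩
    have hr : 0 ≤ M * w 1 / (w 0 * σ) := by have := hw 1; positivity
    rcases k with _ | k
    · rcases i with _ | i
      · simp only [Nat.add_zero, pow_zero, mul_one]
        nlinarith
      · have := hMw 0 i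
        simp only [zero_add] at this ⊢
        calc w (i + 1) ≤ M * σ ^ i * w 1 := this
          _ = M * w 1 / (w 0 * σ) * σ ^ (i + 1) * w 0 := by field_simp; ring
          _ ≤ _ := by gcongr; linarith
    · have := hMw k i
      rw [show k + 1 + i = k + i + 1 by ring]
      refine this.trans ?_
      have := (hw (k + 1)).le
      gcongr
      linarith

lemma exists_forall_add_le {w : ℕ → ℝ} (hw : ∀ n, 0 < w n)
    (hw1 : Tendsto (fun n => w (n + 1) / w n) atTop (nhds 1)) {σ : ℝ} (hσ : 1 < σ) :
    ∃ M : ℝ, 0 < M ∧ ∀ k i, w (k + i) ≤ M * σ ^ i * w k := by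
  obtain ⟨N, hN⟩ := eventually_atTop.1 (hw1.eventually_lt_const hσ)
  exact exists_forall_add_le_of_eventually_le (by linarith) N w hw fun n hn =>
    ((div_lt_iff₀ (hw n)).1 (hN n hn)).le

/-- Young's inequality for the two norms controlled by `SmallError`. -/
lemma SmallError.exists_mul {w : ℕ → ℝ} (hw : ∀ n, 0 < w n)
    (hw1 : Tendsto (fun n => w (n + 1) / w n) atTop (nhds 1)) {h : PowerSeries ℂ}
    (hh : ExpDecay h) :
    ∃ M : ℝ, ∀ n C e, SmallError w n C e → SmallError w n (M * C) (h * e) := by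
  obtain ⟨B, ρ, hB, hρ, hρ1, hhB⟩ := hh
  obtain ⟨σ, hσ, hσρ⟩ := exists_between ((one_lt_div hρ).2 hρ1)
  rw [lt_div_iff₀ hρ] at hσρ
  have hσ0 : 0 < σ := by linarith
  obtain ⟨M, hM, hMw⟩ := exists_forall_add_le hw hw1 hσ
  set a : ℕ → ℝ := fun k => ‖PowerSeries.coeff k h‖ with ha
  have a0 : ∀ k, 0 ≤ a k := fun k => norm_nonneg _
  have sa : Summable a := .of_nonneg_of_le a0 hhB
    ((summable_geometric_of_lt_one hρ.le hρ1).mul_left B)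
  have saσ : Summable fun k => a k * σ ^ k := by
    refine .of_nonneg_of_le (fun k => by have := a0 k; positivity) (fun k => ?_)
      ((summable_geometric_of_lt_one (by positivity) hσρ).mul_left B)
    calc a k * σ ^ k ≤ B * ρ ^ k * σ ^ k := by gcongr; exact hhB k
      _ = B * (σ * ρ) ^ k := by rw [mul_pow]; ring
  set A := ∑' k, a k
  set S := ∑' k, a k * σ ^ k
  have A0 : 0 ≤ A := tsum_nonneg a0
  have S0 : 0 ≤ S := tsum_nonneg fun k => by have := a0 k; positivity
  refine ⟨A + A * M * S, fun n C e he => ?_⟩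
  have hC := he.nonneg
  set b : ℕ → ℝ := fun k => ‖PowerSeries.coeff k e‖ with hb
  have sb : Summable b := he.summable_norm
  set d : ℕ → ℝ := fun k => w k * b k ^ 2 with hd
  have sd : Summable d := he.memHw
  have le1 : ∀ k, ‖PowerSeries.coeff k (h * e)‖ ≤
      ∑ ij ∈ Finset.HasAntidiagonal.antidiagonal k, a ij.1 * b ij.2 := fun k => by
    rw [PowerSeries.coeff_mul]
    exact (norm_sum_le _ _).trans_eq (by simp [ha, hb])
  have le2 : ∀ k, w k * ‖PowerSeries.coeff k (h * e)‖ ^ 2 ≤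
      A * M * ∑ ij ∈ Finset.HasAntidiagonal.antidiagonal k, (a ij.1 * σ ^ ij.1) * d ij.2 := fun k => by
    have cs : (∑ ij ∈ Finset.HasAntidiagonal.antidiagonal k, a ij.1 * b ij.2) ^ 2 ≤
        (∑ ij ∈ Finset.HasAntidiagonal.antidiagonal k, a ij.1) *
          ∑ ij ∈ Finset.HasAntidiagonal.antidiagonal k, a ij.1 * b ij.2 ^ 2 :=
      Finset.sum_sq_le_sum_mul_sum_of_sq_le_mul _ (fun _ _ => a0 _)
        (fun _ _ => mul_nonneg (a0 _) (sq_nonneg _)) (fun _ _ => le_of_eq (by ring))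
    have hA : ∑ ij ∈ Finset.HasAntidiagonal.antidiagonal k, a ij.1 ≤ A := by
      rw [Finset.Nat.sum_antidiagonal_eq_sum_range_succ_mk]
      exact sa.sum_le_tsum _ fun _ _ => a0 _
    have wk := (hw k).le
    calc w k * ‖PowerSeries.coeff k (h * e)‖ ^ 2
        ≤ w k * (∑ ij ∈ Finset.HasAntidiagonal.antidiagonal k, a ij.1 * b ij.2) ^ 2 := by
          gcongr; exact le1 k
      _ ≤ w k * (A * ∑ ij ∈ Finset.HasAntidiagonal.antidiagonal k, a ij.1 * b ij.2 ^ 2) := by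
          refine mul_le_mul_of_nonneg_left (cs.trans ?_) wk
          exact mul_le_mul_of_nonneg_right hA
            (Finset.sum_nonneg fun _ _ => mul_nonneg (a0 _) (sq_nonneg _))
      _ = A * ∑ ij ∈ Finset.HasAntidiagonal.antidiagonal k, w k * (a ij.1 * b ij.2 ^ 2) := by
          rw [← Finset.mul_sum]; ring
      _ ≤ A * ∑ ij ∈ Finset.HasAntidiagonal.antidiagonal k, M * ((a ij.1 * σ ^ ij.1) * d ij.2) := by
          refine mul_le_mul_of_nonneg_left (Finset.sum_le_sum fun ij hij => ?_) A0
          have := hMw ij.2 ij.1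
          rw [add_comm, Finset.HasAntidiagonal.mem_antidiagonal.1 hij] at this
          calc w k * (a ij.1 * b ij.2 ^ 2)
              ≤ (M * σ ^ ij.1 * w ij.2) * (a ij.1 * b ij.2 ^ 2) :=
                mul_le_mul_of_nonneg_right this (mul_nonneg (a0 _) (sq_nonneg _))
            _ = M * ((a ij.1 * σ ^ ij.1) * d ij.2) := by simp only [hd]; ring
      _ = _ := by rw [← Finset.mul_sum]; ring
  have nsa : Summable fun k => ‖a k‖ := sa.norm
  have nsb : Summable fun k => ‖b k‖ := sb.norm
  have nsσ : Summable fun k => ‖a k * σ ^ k‖ := saσ.norm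
  have nsd : Summable fun k => ‖d k‖ := sd.norm
  have s1 := (summable_norm_sum_mul_antidiagonal_of_summable_norm nsa nsb).of_norm
  have s2 := ((summable_norm_sum_mul_antidiagonal_of_summable_norm nsσ nsd).of_norm).mul_left
    (A * M)
  have s1' := Summable.of_nonneg_of_le (fun _ => norm_nonneg _) le1 s1
  have s2' := Summable.of_nonneg_of_le
    (fun k => mul_nonneg (hw k).le (sq_nonneg _)) le2 s2
  refine ⟨s1', ?_, s2', ?_⟩
  · have := s1'.tsum_le_tsum le1 s1
    rw [← tsum_mul_tsum_eq_tsum_sum_antidiagonal_of_summable_norm nsa nsb] at this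
    refine this.trans ?_
    calc A * ∑' k, b k ≤ A * C := by gcongr; exact he.tsum_norm_le
      _ ≤ _ := by gcongr; linarith [mul_nonneg (mul_nonneg A0 hM.le) S0]
  · have := s2'.tsum_le_tsum le2 s2
    rw [tsum_mul_left, ← tsum_mul_tsum_eq_tsum_sum_antidiagonal_of_summable_norm nsσ nsd] at this
    have h2 : phiW w n * ∑' k, d k ≤ C := he.normSqHw_le
    calc phiW w n * normSqHw w (fun k => PowerSeries.coeff k (h * e))
        ≤ phiW w n * (A * M * (S * ∑' k, d k)) :=
          mul_le_mul_of_nonneg_left this (phiW_pos hw n).le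
      _ = A * M * S * (phiW w n * ∑' k, d k) := by ring
      _ ≤ A * M * S * C := by gcongr
      _ ≤ _ := by gcongr; linarith

lemma exists_phiW_mul_le {w : ℕ → ℝ} (hw : ∀ n, 0 < w n)
    (hw1 : Tendsto (fun n => w (n + 1) / w n) atTop (nhds 1)) {σ : ℝ} (hσ : 1 < σ) :
    ∃ M : ℝ, 0 ≤ M ∧ ∀ n k, n ≤ k → phiW w n * w k ≤ M * σ ^ k := by
  obtain ⟨M, hM, hMw⟩ := exists_forall_add_le hw hw1 hσ
  have hσ0 : 0 < σ := by linarith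
  have hσ1 : σ⁻¹ < 1 := inv_lt_one_of_one_lt₀ hσ
  have hs := summable_geometric_of_lt_one (inv_nonneg.2 hσ0.le) hσ1
  refine ⟨M * ∑' j, σ⁻¹ ^ j, mul_nonneg hM.le (tsum_nonneg fun _ => by positivity),
    fun n k hnk => ?_⟩
  calc phiW w n * w k = ∑ j ∈ Finset.range (n + 1), 1 / w j * w k := Finset.sum_mul _ _ _
    _ ≤ ∑ j ∈ Finset.range (n + 1), M * σ ^ k * σ⁻¹ ^ j := by
        refine Finset.sum_le_sum fun j hj => ?_
        have hjk : j ≤ k := by have := Finset.mem_range.1 hj; omega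
        have := hMw j (k - j)
        rw [Nat.add_sub_cancel' hjk, pow_sub₀ _ hσ0.ne' hjk, ← inv_pow] at this
        rw [one_div_mul_eq_div, div_le_iff₀ (hw j)]
        linarith
    _ = M * σ ^ k * ∑ j ∈ Finset.range (n + 1), σ⁻¹ ^ j := by rw [Finset.mul_sum]
    _ ≤ M * σ ^ k * ∑' j, σ⁻¹ ^ j := by
        gcongr
        exact hs.sum_le_tsum _ fun _ _ => by positivity
    _ = _ := by ring

/-- The Taylor polynomial of `g` of degree at most `n`. -/
noncomputable def truncSeries (n : ℕ) (g : PowerSeries ℂ) : PowerSeries ℂ :=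
  PowerSeries.mk fun k => if k ≤ n then PowerSeries.coeff k g else 0

lemma exists_smallError_truncSeries_sub {w : ℕ → ℝ} (hw : ∀ n, 0 < w n)
    (hw1 : Tendsto (fun n => w (n + 1) / w n) atTop (nhds 1)) {g : PowerSeries ℂ}
    (hg : ExpDecay g) :
    ∃ C : ℝ, ∀ n, SmallError w n C (truncSeries n g - g) := by
  obtain ⟨B, ρ, hB, hρ, hρ1, hgB⟩ := hg
  obtain ⟨σ, hσ, hσρ⟩ := exists_between ((one_lt_div hρ).2 hρ1)
  rw [lt_div_iff₀ hρ] at hσρ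
  have hσ0 : 0 < σ := by linarith
  obtain ⟨M, hM, hMw⟩ := exists_phiW_mul_le hw hw1 hσ
  have s1 := (summable_geometric_of_lt_one hρ.le hρ1).mul_left B
  have s2 := (summable_geometric_of_lt_one (mul_pos hσ0 hρ).le hσρ).mul_left (M * B ^ 2)
  refine ⟨max (∑' k, B * ρ ^ k) (∑' k, M * B ^ 2 * (σ * ρ) ^ k), fun n => ?_⟩
  have le1 : ∀ k, ‖PowerSeries.coeff k (truncSeries n g - g)‖ ≤ B * ρ ^ k := fun k => by
    by_cases hk : k ≤ n
    · simp only [truncSeries, map_sub, PowerSeries.coeff_mk, hk, if_true, sub_self, norm_zero]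
      positivity
    · simpa [truncSeries, hk] using hgB k
  have le2 : ∀ k, phiW w n * (w k * ‖PowerSeries.coeff k (truncSeries n g - g)‖ ^ 2) ≤
      M * B ^ 2 * (σ * ρ) ^ k := fun k => by
    by_cases hk : k ≤ n
    · simp only [truncSeries, map_sub, PowerSeries.coeff_mk, hk, if_true, sub_self, norm_zero]
      have : 0 ≤ M * B ^ 2 * (σ * ρ) ^ k := by positivity
      simpa using this
    · calc _ = (phiW w n * w k) * ‖PowerSeries.coeff k (truncSeries n g - g)‖ ^ 2 := by ring
        _ ≤ (M * σ ^ k) * (B * ρ ^ k) ^ 2 := by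
            exact mul_le_mul (hMw n k (by omega)) (pow_le_pow_left₀ (norm_nonneg _) (le1 k) 2)
              (sq_nonneg _) (by positivity)
        _ = M * B ^ 2 * (σ * ρ) ^ k * ρ ^ k := by rw [mul_pow, mul_pow]; ring
        _ ≤ M * B ^ 2 * (σ * ρ) ^ k * 1 := by gcongr; exact pow_le_one₀ hρ.le hρ1.le
        _ = _ := mul_one _
  have hφ := phiW_pos hw n
  have s1' := Summable.of_nonneg_of_le (fun _ => norm_nonneg _) le1 s1
  have s2' := Summable.of_nonneg_of_le
    (fun k => mul_nonneg hφ.le (mul_nonneg (hw k).le (sq_nonneg _))) le2 s2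
  refine ⟨s1', (s1'.tsum_le_tsum le1 s1).trans (le_max_left _ _),
    (summable_mul_left_iff hφ.ne').1 s2', ?_⟩
  have := s2'.tsum_le_tsum le2 s2
  rw [tsum_mul_left] at this
  exact this.trans (le_max_right _ _)

lemma approximable_mul {w : ℕ → ℝ} (hw : ∀ n, 0 < w n)
    (hw1 : Tendsto (fun n => w (n + 1) / w n) atTop (nhds 1)) {f g : PowerSeries ℂ}
    (hf : ExpDecay f) (hg : ExpDecay g) : Approximable w f (f * g) := by
  obtain ⟨M, hM⟩ := SmallError.exists_mul hw hw1 hf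
  obtain ⟨C, hC⟩ := exists_smallError_truncSeries_sub hw hw1 hg
  refine ⟨M * C, fun n => ⟨truncSeries n g, fun m hm => ?_, ?_⟩⟩
  · simp [truncSeries, hm]
  · convert hM n C _ (hC n) using 1
    ring

/-- The optimal polynomial of degree at most `n` with value `1` at `ζ⁻¹`, when `‖ζ‖ = 1`. -/
noncomputable def kernelSeries (w : ℕ → ℝ) (ζ : ℂ) (n : ℕ) : PowerSeries ℂ :=
  PowerSeries.mk fun k => if k ≤ n then ζ ^ k * ((1 / w k / phiW w n : ℝ) : ℂ) else 0

/-- The quotient `(1 - kernelSeries w ζ n) / (1 - ζ X)`. -/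
noncomputable def kernelQuotient (w : ℕ → ℝ) (ζ : ℂ) (n : ℕ) : PowerSeries ℂ :=
  PowerSeries.mk fun k => if k ≤ n then ζ ^ k * ((1 - phiW w k / phiW w n : ℝ) : ℂ) else 0

lemma kernelQuotient_mul {w : ℕ → ℝ} (hw : ∀ n, 0 < w n) (ζ : ℂ) (n : ℕ) :
    kernelQuotient w ζ n * (1 - PowerSeries.C ζ * PowerSeries.X) = 1 - kernelSeries w ζ n := by
  have hφ := (phiW_pos hw n).ne'
  have e : kernelQuotient w ζ n * (1 - PowerSeries.C ζ * PowerSeries.X) =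
      kernelQuotient w ζ n - PowerSeries.C ζ * (kernelQuotient w ζ n * PowerSeries.X) := by ring
  rw [e]
  ext k
  rw [map_sub, PowerSeries.coeff_C_mul, map_sub, PowerSeries.coeff_one]
  rcases k with _ | k
  · simp [kernelQuotient, kernelSeries, phiW]
  · rw [PowerSeries.coeff_succ_mul_X]
    simp only [kernelQuotient, kernelSeries, PowerSeries.coeff_mk]
    have hs : phiW w (k + 1) = phiW w k + 1 / w (k + 1) := Finset.sum_range_succ _ _
    by_cases h1 : k + 1 ≤ n
    · simp only [h1, if_true, (Nat.le_succ k).trans h1, hs]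
      push_cast
      ring
    · by_cases h2 : k = n
      · subst h2
        simp [hφ]
      · have h3 : ¬ k ≤ n := by omega
        simp [h1, h3]

lemma smallError_kernelSeries {w : ℕ → ℝ} (hw : ∀ n, 0 < w n) {ζ : ℂ} (hζ : ‖ζ‖ = 1) (n : ℕ) :
    SmallError w n 1 (kernelSeries w ζ n) := by
  have hφ := phiW_pos hw n
  have norm_eq : ∀ k ≤ n, ‖PowerSeries.coeff k (kernelSeries w ζ n)‖ = 1 / w k / phiW w n :=
    fun k hk => by
      simp only [kernelSeries, PowerSeries.coeff_mk, hk, if_true, norm_mul, norm_pow, hζ, one_pow,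
        one_mul, Complex.norm_real]
      exact Real.norm_of_nonneg (div_nonneg (one_div_pos.2 (hw k)).le hφ.le)
  have zero : ∀ k ∉ Finset.range (n + 1), PowerSeries.coeff k (kernelSeries w ζ n) = 0 :=
    fun k hk => by
      have : ¬ k ≤ n := by simpa using hk
      simp [kernelSeries, this]
  have zero1 : ∀ k ∉ Finset.range (n + 1), ‖PowerSeries.coeff k (kernelSeries w ζ n)‖ = 0 :=
    fun k hk => by rw [zero k hk, norm_zero]
  have zero2 : ∀ k ∉ Finset.range (n + 1),
      w k * ‖PowerSeries.coeff k (kernelSeries w ζ n)‖ ^ 2 = 0 :=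
    fun k hk => by rw [zero1 k hk]; simp
  refine ⟨summable_of_ne_finset_zero zero1, ?_, summable_of_ne_finset_zero zero2, ?_⟩
  · rw [tsum_eq_sum zero1, Finset.sum_congr rfl fun k hk =>
      norm_eq k (Nat.lt_succ_iff.1 (Finset.mem_range.1 hk)), ← Finset.sum_div]
    exact (div_self hφ.ne').le
  · unfold normSqHw
    have : ∀ k ∈ Finset.range (n + 1), w k * ‖PowerSeries.coeff k (kernelSeries w ζ n)‖ ^ 2 =
        1 / w k / phiW w n ^ 2 := fun k hk => by
      rw [norm_eq k (Nat.lt_succ_iff.1 (Finset.mem_range.1 hk))]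
      have := hw k
      field_simp
    rw [tsum_eq_sum zero2, Finset.sum_congr rfl this, ← Finset.sum_div]
    change phiW w n * (phiW w n / phiW w n ^ 2) ≤ 1
    exact (by field_simp : phiW w n * (phiW w n / phiW w n ^ 2) = 1).le

lemma approximable_of_mul_eq {w : ℕ → ℝ} (hw : ∀ n, 0 < w n)
    (hw1 : Tendsto (fun n => w (n + 1) / w n) atTop (nhds 1)) {f a : PowerSeries ℂ}
    (ha : ExpDecay a) {ζ : ℂ} (hζ : ‖ζ‖ = 1)
    (h : (1 - PowerSeries.C ζ * PowerSeries.X) * a = f) : Approximable w f a := by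
  obtain ⟨M, hM⟩ := SmallError.exists_mul hw hw1 ha
  refine ⟨(‖(-1 : ℂ)‖ + ‖(-1 : ℂ)‖ ^ 2) * (M * 1), fun n =>
    ⟨kernelQuotient w ζ n, fun m hm => ?_, ?_⟩⟩
  · simp [kernelQuotient, hm]
  · convert (hM n 1 _ (smallError_kernelSeries hw hζ n)).smul (-1) using 1
    rw [← h, ← mul_assoc, kernelQuotient_mul hw, neg_one_smul]
    ring

/-- The Taylor series of `F` at `0` as a formal power series. -/
noncomputable def taylorPS (F : ℂ → ℂ) : PowerSeries ℂ := PowerSeries.mk (taylorCoeff F)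

lemma taylorPS_congr {F G : ℂ → ℂ} (h : F =ᶠ[nhds 0] G) : taylorPS F = taylorPS G := by
  ext n
  simp [taylorPS, taylorCoeff, h.iteratedDeriv_eq]

lemma taylorPS_add {F G : ℂ → ℂ} (hF : AnalyticAt ℂ F 0) (hG : AnalyticAt ℂ G 0) :
    taylorPS (F + G) = taylorPS F + taylorPS G := by
  ext n
  simp [taylorPS, taylorCoeff, iteratedDeriv_add hF.contDiffAt hG.contDiffAt, add_div]

lemma taylorPS_smul {F : ℂ → ℂ} (hF : AnalyticAt ℂ F 0) (c : ℂ) :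
    taylorPS (c • F) = c • taylorPS F := by
  ext n
  simp [taylorPS, taylorCoeff, iteratedDeriv_const_smul hF.contDiffAt, mul_div_assoc]

lemma taylorPS_mul {F G : ℂ → ℂ} (hF : AnalyticAt ℂ F 0) (hG : AnalyticAt ℂ G 0) :
    taylorPS (F * G) = taylorPS F * taylorPS G := by
  ext n
  rw [PowerSeries.coeff_mul, Finset.Nat.sum_antidiagonal_eq_sum_range_succ_mk]
  simp only [taylorPS, taylorCoeff, PowerSeries.coeff_mk,
    iteratedDeriv_mul hF.contDiffAt hG.contDiffAt, Finset.sum_div]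
  refine Finset.sum_congr rfl fun k hk => ?_
  have hk : k ≤ n := Nat.lt_succ_iff.1 (Finset.mem_range.1 hk)
  rw [Nat.cast_choose ℂ hk]
  have h1 : (n.factorial : ℂ) ≠ 0 := mod_cast n.factorial_ne_zero
  have h2 : (k.factorial : ℂ) ≠ 0 := mod_cast k.factorial_ne_zero
  have h3 : ((n - k).factorial : ℂ) ≠ 0 := mod_cast (n - k).factorial_ne_zero
  field_simp

lemma taylorPS_one : taylorPS (fun _ => 1) = 1 := by
  ext n
  simp only [taylorPS, taylorCoeff, PowerSeries.coeff_mk, PowerSeries.coeff_one,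
    iteratedDeriv_const]
  split_ifs with h <;> simp [h]

lemma taylorPS_one_sub_mul (ζ : ℂ) :
    taylorPS (fun z => 1 - ζ * z) = 1 - PowerSeries.C ζ * PowerSeries.X := by
  have hid : taylorPS (fun z => z) = PowerSeries.X := by
    ext n
    simp only [taylorPS, taylorCoeff, PowerSeries.coeff_mk, PowerSeries.coeff_X,
      iteratedDeriv_fun_id_zero]
    split_ifs with h <;> simp [h]
  have e : (fun z : ℂ => 1 - ζ * z) = (fun _ => 1) + (-ζ) • fun z => z := by
    ext z; simp; ring
  rw [e, taylorPS_add (by fun_prop) (by fun_prop), taylorPS_smul (by fun_prop), taylorPS_one,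
    hid, PowerSeries.smul_eq_C_mul]
  simp [sub_eq_add_neg]

lemma expDecay_taylorPS {R : ℝ} (hR : 1 < R) {F : ℂ → ℂ}
    (hF : DifferentiableOn ℂ F (Metric.ball 0 R)) : ExpDecay (taylorPS F) := by
  obtain ⟨r, hr, hrR⟩ := exists_between hR
  have hr0 : 0 < r := by linarith
  have hz : (r : ℂ) ∈ Metric.ball (0 : ℂ) R := by
    simpa [abs_of_pos hr0] using hrR
  have hs := (Complex.hasSum_taylorSeries_on_ball hF hz).summable.tendsto_atTop_zero
  obtain ⟨B, hB⟩ := hs.norm.bddAbove_range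
  refine ⟨max B 1, r⁻¹, by positivity, by positivity, inv_lt_one_of_one_lt₀ hr, fun k => ?_⟩
  have h := hB ⟨k, rfl⟩
  rw [inv_pow, ← div_eq_mul_inv, le_div_iff₀ (by positivity)]
  refine le_trans (le_of_eq ?_) (h.trans (le_max_left _ _))
  simp [taylorPS, taylorCoeff, abs_of_pos hr0]
  ring

/-- The functions whose Taylor series are directly seen to be approximable by multiples of `F`. -/
def approxGenerators (R : ℝ) (F : ℂ → ℂ) : Set (ℂ → ℂ) :=
  {A | DifferentiableOn ℂ A (Metric.ball 0 R) ∧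
    ((∃ ζ : ℂ, ‖ζ‖ = 1 ∧ ∀ z ∈ Metric.ball (0 : ℂ) R, (1 - ζ * z) * A z = F z) ∨
      ∃ G : ℂ → ℂ, DifferentiableOn ℂ G (Metric.ball 0 R) ∧
        ∀ z ∈ Metric.ball (0 : ℂ) R, A z = F z * G z)}

lemma approximable_of_mem_span {w : ℕ → ℝ} (hw : ∀ n, 0 < w n)
    (hw1 : Tendsto (fun n => w (n + 1) / w n) atTop (nhds 1)) {R : ℝ} (hR : 1 < R)
    {F : ℂ → ℂ} (hF : DifferentiableOn ℂ F (Metric.ball 0 R)) {A : ℂ → ℂ}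
    (hA : A ∈ Submodule.span ℂ (approxGenerators R F)) :
    Approximable w (taylorPS F) (taylorPS A) := by
  have hball : Metric.ball (0 : ℂ) R ∈ nhds 0 := Metric.ball_mem_nhds _ (by linarith)
  suffices AnalyticAt ℂ A 0 ∧ Approximable w (taylorPS F) (taylorPS A) from this.2
  induction hA using Submodule.span_induction with
  | mem A hA =>
    obtain ⟨hd, ⟨ζ, hζ, h⟩ | ⟨G, hG, h⟩⟩ := hA
    · refine ⟨hd.analyticAt hball, approximable_of_mul_eq hw hw1 (expDecay_taylorPS hR hd) hζ ?_⟩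
      rw [← taylorPS_one_sub_mul, ← taylorPS_mul (by fun_prop) (hd.analyticAt hball)]
      exact taylorPS_congr (eventually_of_mem hball h)
    · refine ⟨hd.analyticAt hball, ?_⟩
      rw [taylorPS_congr (eventually_of_mem hball h : A =ᶠ[nhds 0] F * G),
        taylorPS_mul (hF.analyticAt hball) (hG.analyticAt hball)]
      exact approximable_mul hw hw1 (expDecay_taylorPS hR hF) (expDecay_taylorPS hR hG)
  | zero =>
    refine ⟨analyticAt_const, ?_⟩
    have := (approximable_mul hw hw1 (expDecay_taylorPS hR hF)
      (expDecay_taylorPS hR hF)).smul 0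
    rw [zero_smul] at this
    convert this using 1
    ext n
    simp [taylorPS, taylorCoeff]
  | add A B _ _ hA hB =>
    refine ⟨hA.1.add hB.1, ?_⟩
    rw [taylorPS_add hA.1 hB.1]
    exact hA.2.add hw hB.2
  | smul c A _ hA =>
    refine ⟨analyticAt_const.smul hA.1, ?_⟩
    rw [taylorPS_smul hA.1]
    exact hA.2.smul c

lemma differentiableOn_dslope_ball {R : ℝ} {G : ℂ → ℂ}
    (hG : DifferentiableOn ℂ G (Metric.ball 0 R)) {a : ℂ} (ha : a ∈ Metric.ball (0 : ℂ) R) :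
    DifferentiableOn ℂ (dslope G a) (Metric.ball 0 R) :=
  (Complex.differentiableOn_dslope (Metric.isOpen_ball.mem_nhds ha)).2 hG

lemma one_sub_mul_mul_dslope {G : ℂ → ℂ} {a : ℂ} (ha : a ≠ 0) (z : ℂ) :
    (1 - a⁻¹ * z) * (-a * dslope G a z) = G z - G a := by
  rw [← sub_smul_dslope G a z, smul_eq_mul]
  field_simp
  ring

lemma span_approxGenerators_le {R : ℝ} (hR : 1 < R) {F F₁ : ℂ → ℂ} {a : ℂ} (ha : ‖a‖ = 1)
    (hF₁ : DifferentiableOn ℂ F₁ (Metric.ball 0 R)) (hF₁a : F₁ a ≠ 0)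
    (h : ∀ z ∈ Metric.ball (0 : ℂ) R, (1 - a⁻¹ * z) * F₁ z = F z) :
    Submodule.span ℂ (approxGenerators R F₁) ≤ Submodule.span ℂ (approxGenerators R F) := by
  have ha0 : a ≠ 0 := fun h => by simp [h] at ha
  have haR : a ∈ Metric.ball (0 : ℂ) R := by simpa [ha] using hR
  have hai : ‖a⁻¹‖ = 1 := by simp [ha]
  have mem₁ : F₁ ∈ Submodule.span ℂ (approxGenerators R F) :=
    Submodule.subset_span ⟨hF₁, Or.inl ⟨a⁻¹, hai, h⟩⟩
  rw [Submodule.span_le]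
  rintro A ⟨hA, ⟨ζ, hζ, hAζ⟩ | ⟨G, hG, hAG⟩⟩
  · have hne : a⁻¹ - ζ ≠ 0 := fun h0 => by
      have := hAζ a haR
      rw [← sub_eq_zero.1 h0, inv_mul_cancel₀ ha0, sub_self, zero_mul] at this
      exact hF₁a this.symm
    have hζ0 : ζ ≠ 0 := fun h => by simp [h] at hζ
    have memA : (fun z => (1 - a⁻¹ * z) * A z) ∈ Submodule.span ℂ (approxGenerators R F) := by
      refine Submodule.subset_span ⟨by fun_prop, Or.inl ⟨ζ, hζ, fun z hz => ?_⟩⟩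
      rw [← h z hz, ← hAζ z hz]
      ring
    have memB : A - (a⁻¹ / (a⁻¹ - ζ)) • F₁ ∈ Submodule.span ℂ (approxGenerators R F) := by
      rw [← (Submodule.span ℂ (approxGenerators R F)).smul_mem_iff
        (div_ne_zero hne (neg_ne_zero.2 hζ0))]
      refine Submodule.subset_span ⟨(hA.sub (hF₁.const_smul _)).const_smul _,
        Or.inl ⟨ζ, hζ, fun z hz => ?_⟩⟩
      simp only [Pi.smul_apply, Pi.sub_apply, smul_eq_mul]
      rw [← h z hz, ← hAζ z hz]
      have := hne
      generalize a⁻¹ = b at *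
      field_simp
      ring
    simpa using Submodule.add_mem _ memB (Submodule.smul_mem _ (a⁻¹ / (a⁻¹ - ζ)) mem₁)
  · have memB : A - G a • F₁ ∈ Submodule.span ℂ (approxGenerators R F) := by
      refine Submodule.subset_span ⟨hA.sub (hF₁.const_smul _), Or.inr
        ⟨fun z => -a * dslope G a z, (differentiableOn_dslope_ball hG haR).const_mul _,
          fun z hz => ?_⟩⟩
      simp only [Pi.smul_apply, Pi.sub_apply, smul_eq_mul]
      rw [← h z hz, hAG z hz, mul_right_comm, one_sub_mul_mul_dslope ha0]
      ring
    simpa using Submodule.add_mem _ memB (Submodule.smul_mem _ (G a) mem₁)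

lemma exists_ball_forall_ne_zero {R : ℝ} (hR : 1 < R) {F : ℂ → ℂ}
    (hF : ContinuousOn F (Metric.ball 0 R)) (h0 : ∀ z : ℂ, ‖z‖ ≤ 1 → F z ≠ 0) :
    ∃ R' : ℝ, 1 < R' ∧ R' ≤ R ∧ ∀ z ∈ Metric.ball (0 : ℂ) R', F z ≠ 0 := by
  have hopen : IsOpen (Metric.ball (0 : ℂ) R ∩ F ⁻¹' {0}ᶜ) :=
    hF.isOpen_inter_preimage Metric.isOpen_ball isOpen_compl_singleton
  obtain ⟨δ, hδ, hsub⟩ := (isCompact_closedBall (0 : ℂ) 1).exists_thickening_subset_open hopen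
    fun z hz => ⟨Metric.closedBall_subset_ball hR hz, h0 z (by simpa using hz)⟩
  rw [thickening_closedBall hδ zero_le_one] at hsub
  exact ⟨min (δ + 1) R, lt_min (by linarith) hR, min_le_right _ _, fun z hz =>
    (hsub (Metric.ball_subset_ball (min_le_left _ _) hz)).2⟩

lemma exists_one_mem_span {R : ℝ} (hR : 1 < R) (s : Finset ℂ) :
    ∀ F : ℂ → ℂ, DifferentiableOn ℂ F (Metric.ball 0 R) → (∀ z ∈ s, ‖z‖ = 1) →
      (∀ z : ℂ, ‖z‖ ≤ 1 → (F z = 0 ↔ z ∈ s)) → (∀ z ∈ s, deriv F z ≠ 0) →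
      ∃ R' : ℝ, 1 < R' ∧ R' ≤ R ∧
        (fun _ => 1 : ℂ → ℂ) ∈ Submodule.span ℂ (approxGenerators R' F) := by
  induction s using Finset.induction_on with
  | empty =>
    intro F hF _ hzero _
    obtain ⟨R', h1, h2, h3⟩ := exists_ball_forall_ne_zero hR hF.continuousOn
      fun z hz h => by simpa using (hzero z hz).1 h
    refine ⟨R', h1, h2, Submodule.subset_span ⟨differentiableOn_const _, Or.inr
      ⟨fun z => (F z)⁻¹, (hF.mono (Metric.ball_subset_ball h2)).fun_inv h3, fun z hz => ?_⟩⟩⟩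
    exact (mul_inv_cancel₀ (h3 z hz)).symm
  | insert a s has ih =>
    intro F hF hs hzero hderiv
    have ha := hs a (Finset.mem_insert_self a s)
    have ha0 : a ≠ 0 := fun h => by simp [h] at ha
    have haR : a ∈ Metric.ball (0 : ℂ) R := by simpa [ha] using hR
    have hFa : F a = 0 := (hzero a ha.le).2 (Finset.mem_insert_self a s)
    set F₁ : ℂ → ℂ := fun z => -a * dslope F a z with hF₁_def
    have hF₁ : DifferentiableOn ℂ F₁ (Metric.ball 0 R) :=
      (differentiableOn_dslope_ball hF haR).const_mul _
    have hmul : ∀ z, (1 - a⁻¹ * z) * F₁ z = F z := fun z => by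
      rw [hF₁_def, one_sub_mul_mul_dslope ha0, hFa, sub_zero]
    have hF₁a : F₁ a ≠ 0 := by
      simpa [hF₁_def, dslope_same, ha0] using hderiv a (Finset.mem_insert_self a s)
    have hzero₁ : ∀ z : ℂ, ‖z‖ ≤ 1 → (F₁ z = 0 ↔ z ∈ s) := fun z hz => by
      by_cases hza : z = a
      · subst hza
        exact iff_of_false hF₁a has
      · have hne : 1 - a⁻¹ * z ≠ 0 := fun h => hza <| by
          rw [sub_eq_zero, ← div_eq_inv_mul, eq_comm, div_eq_one_iff_eq ha0] at h
          exact h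
        have := hzero z hz
        rw [← hmul z, mul_eq_zero, or_iff_right hne, Finset.mem_insert, or_iff_right hza] at this
        exact this
    have hderiv₁ : ∀ z ∈ s, deriv F₁ z ≠ 0 := fun z hz h => by
      have hz1 := hs z (Finset.mem_insert_of_mem hz)
      refine hderiv z (Finset.mem_insert_of_mem hz) ?_
      have hd : HasDerivAt F₁ 0 z := h ▸ (hF₁.differentiableAt
        (Metric.isOpen_ball.mem_nhds (by simpa [hz1] using hR))).hasDerivAt
      have hl : HasDerivAt (fun z : ℂ => 1 - a⁻¹ * z) (-(a⁻¹ * 1)) z :=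
        ((hasDerivAt_id z).const_mul a⁻¹).const_sub 1
      have := (hl.mul hd).deriv
      rw [(hzero₁ z hz1.le).2 hz, mul_zero, mul_zero, add_zero] at this
      rw [← this]
      congr 1
      ext z
      exact (hmul z).symm
    obtain ⟨R', h1, h2, h3⟩ := ih F₁ hF₁ (fun z hz => hs z (Finset.mem_insert_of_mem hz))
      hzero₁ hderiv₁
    exact ⟨R', h1, h2, span_approxGenerators_le h1 ha (hF₁.mono (Metric.ball_subset_ball h2)) hF₁a
      (fun z _ => hmul z) h3⟩

lemma finite_zeros_closedBall {R : ℝ} (hR : 1 < R) {F : ℂ → ℂ}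
    (hF : AnalyticOnNhd ℂ F (Metric.ball 0 R)) (h0 : F 0 ≠ 0) :
    {z : ℂ | ‖z‖ ≤ 1 ∧ F z = 0}.Finite := by
  by_contra hinf
  obtain ⟨x, hx, hacc⟩ := Set.Infinite.exists_accPt_of_subset_isCompact hinf
    (isCompact_closedBall (0 : ℂ) 1) fun z hz => by simpa using hz.1
  refine h0 (hF.eqOn_zero_of_preconnected_of_frequently_eq_zero
    (convex_ball (0 : ℂ) R).isPreconnected (Metric.closedBall_subset_ball hR hx)
    ((accPt_iff_frequently_nhdsNE.1 hacc).mono fun z hz => hz.2) ?_)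
  simpa using by linarith

theorem rate_for_simple_boundary_zeros
    (w : ℕ → ℝ) (hw : ∀ n, 0 < w n)
    (hw1 : Filter.Tendsto (fun n => w (n + 1) / w n) Filter.atTop (nhds 1))
    (R : ℝ) (hR : 1 < R) (F : ℂ → ℂ)
    (hF : ∀ z ∈ Metric.ball (0 : ℂ) R, AnalyticAt ℂ F z)
    (hFz : ∀ z : ℂ, ‖z‖ < 1 → F z ≠ 0)
    (hsimple : ∀ z : ℂ, ‖z‖ = 1 → F z = 0 → deriv F z ≠ 0) :
    ∃ C : ℝ, 0 < C ∧ ∀ n : ℕ, 1 ≤ n →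
      ∃ p : ℕ → ℂ, DegLE p n ∧
        (Summable fun k => ‖cProd p (taylorCoeff F) k‖) ∧
        (∑' k, ‖cProd p (taylorCoeff F) k‖) ≤ C ∧
        normSqHw w (cProd p (taylorCoeff F) - onePS) ≤ C / phiW w n := by
  have hF' : AnalyticOnNhd ℂ F (Metric.ball 0 R) := hF
  have hfin := finite_zeros_closedBall hR hF' (hFz 0 (by simp))
  have norm_eq : ∀ z : ℂ, ‖z‖ ≤ 1 → F z = 0 → ‖z‖ = 1 := fun z hz h0 =>
    hz.antisymm (not_lt.1 fun h => hFz z h h0)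
  obtain ⟨R', hR', hR'R, hmem⟩ := exists_one_mem_span hR hfin.toFinset F hF'.differentiableOn
    (fun z hz => by
      have := hfin.mem_toFinset.1 hz
      exact norm_eq z this.1 this.2)
    (fun z hz => ⟨fun h => hfin.mem_toFinset.2 ⟨hz, h⟩, fun h => (hfin.mem_toFinset.1 h).2⟩)
    (fun z hz => by
      have := hfin.mem_toFinset.1 hz
      exact hsimple z (norm_eq z this.1 this.2) this.2)
  have happ := approximable_of_mem_span hw hw1 hR'
    (hF'.differentiableOn.mono (Metric.ball_subset_ball hR'R)) hmem
  rw [taylorPS_one] at happ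
  obtain ⟨C, hC⟩ := happ
  have hC0 : 0 ≤ C := by
    obtain ⟨p, -, h⟩ := hC 0
    exact h.nonneg
  refine ⟨C + 1, by linarith, fun n _ => ?_⟩
  obtain ⟨p, hp, he⟩ := hC n
  set e := p * taylorPS F - 1 with he_def
  have hprod : cProd (fun k => PowerSeries.coeff k p) (taylorCoeff F) =
      fun k => PowerSeries.coeff k e + onePS k := by
    ext k
    rw [he_def, map_sub, PowerSeries.coeff_mul, PowerSeries.coeff_one,
      Finset.Nat.sum_antidiagonal_eq_sum_range_succ_mk]
    simp [cProd, onePS, taylorPS]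
  have hone : HasSum (fun k => ‖onePS k‖) 1 := by
    convert hasSum_ite_eq (0 : ℕ) (1 : ℝ) using 2 with k
    unfold onePS
    split_ifs <;> simp
  have le1 : ∀ k, ‖PowerSeries.coeff k e + onePS k‖ ≤ ‖PowerSeries.coeff k e‖ + ‖onePS k‖ :=
    fun k => norm_add_le _ _
  have s1 := he.summable_norm.add hone.summable
  have s1' := Summable.of_nonneg_of_le (fun _ => norm_nonneg _) le1 s1
  refine ⟨fun k => PowerSeries.coeff k p, hp, ?_, ?_, ?_⟩
  · rwa [hprod]
  · rw [hprod]
    refine (s1'.tsum_le_tsum le1 s1).trans ?_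
    rw [he.summable_norm.tsum_add hone.summable, hone.tsum_eq]
    linarith [he.tsum_norm_le]
  · have hsub : cProd (fun k => PowerSeries.coeff k p) (taylorCoeff F) - onePS =
        fun k => PowerSeries.coeff k e := by
      rw [hprod]
      ext k
      simp
    rw [hsub, le_div_iff₀' (phiW_pos hw n)]
    linarith [he.normSqHw_le]
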